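/- arXiv:1511.06093 — 3 statements merged into one kernel-verified Lean document; each statement's English description precedes it below -/
import Mathlib

section
/- Let (x⁰_i)_{i∈ℕ} and (x¹_i)_{i∈ℕ} be two C-unconditional Schauder bases for a Banach space X with biorthogonal functionals (x⁰*_i) and (x¹*_i). Suppose that for every σ : ℕ → {0,1}, the pair (x^{σ(i)}_i, x^{σ(i)*}_i)_{i∈ℕ} is an unconditional approximate Schauder frame for X. Then there exists E > 0 such that for every σ : ℕ → {0,1}, letting P be the basis projection of (x⁰_i) onto [x⁰_i]_{i∈σ⁻¹(0)} and Q the basis projection of (x¹_i) onto [x¹_i]_{i∈σ⁻¹(0)}, the restrictions P|_{[x¹_i]_{i∈σ⁻¹(0)}} : [x¹_i]_{i∈σ⁻¹(0)} → [x⁰_i]_{i∈σ⁻¹(0)} and Q|_{[x⁰_i]_{i∈σ⁻¹(0)}} : [x⁰_i]_{i∈σ⁻¹(0)} → [x¹_i]_{i∈σ⁻¹(0)} are bijective with inverses of norm at most E. -/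
open Filter Topology

variable {X : Type*} [NormedAddCommGroup X] [NormedSpace ℝ X] [CompleteSpace X]

/-- The weaving of two sequences determined by `σ : ℕ → Bool`
(`σ j = false` selects the first sequence, `σ j = true` the second). -/
def weave {α : Type*} (g0 g1 : ℕ → α) (σ : ℕ → Bool) (j : ℕ) : α :=
  if σ j then g1 j else g0 j

/-- `x` is a `C`-unconditional Schauder basis of `X` with biorthogonal
functionals `xs`: the system is biorthogonal, every vector has an
unconditionally convergent expansion, and all set-projections of the
expansion are bounded by `C`. -/
def IsUncondBasisWith (x : ℕ → X) (xs : ℕ → X →L[ℝ] ℝ) (C : ℝ) : Prop :=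
  (∀ i j, xs i (x j) = if i = j then 1 else 0) ∧
  (∀ v : X, HasSum (fun j => xs j v • x j) v) ∧
  (∀ (v : X) (E : Set ℕ), ‖∑' j : E, xs (j : ℕ) v • x (j : ℕ)‖ ≤ C * ‖v‖)

/-- `[x_i]_{i ∈ Γ}`, the closed linear span of `{x i : i ∈ Γ}`. -/
def sspan (x : ℕ → X) (Γ : Set ℕ) : Submodule ℝ X :=
  (Submodule.span ℝ (x '' Γ)).topologicalClosure

/-- The basis projection onto `[x_i]_{i ∈ Γ}`, given pointwise by
`v ↦ ∑_{i ∈ Γ} xs i (v) • x i`. -/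
noncomputable def bproj (x : ℕ → X) (xs : ℕ → X →L[ℝ] ℝ) (Γ : Set ℕ) (v : X) : X :=
  ∑' i : Γ, xs (i : ℕ) v • x (i : ℕ)

/-- For a given `σ`, with `Γ = σ⁻¹(0)`, `P` the basis projection of `(x0, xs0)` onto
`[x0_i]_{i ∈ Γ}` and `Q` the basis projection of `(x1, xs1)` onto `[x1_i]_{i ∈ Γ}`,
the restrictions `P|_{[x1_i]_{i ∈ Γ}} : [x1_i]_{i ∈ Γ} → [x0_i]_{i ∈ Γ}` and
`Q|_{[x0_i]_{i ∈ Γ}} : [x0_i]_{i ∈ Γ} → [x1_i]_{i ∈ Γ}` are bijective with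
inverses of norm at most `E`. -/
def RestrictionsInvertible (x0 x1 : ℕ → X) (xs0 xs1 : ℕ → X →L[ℝ] ℝ)
    (σ : ℕ → Bool) (E : ℝ) : Prop :=
  (∀ u ∈ sspan x1 {i | σ i = false},
      bproj x0 xs0 {i | σ i = false} u ∈ sspan x0 {i | σ i = false} ∧
      ‖u‖ ≤ E * ‖bproj x0 xs0 {i | σ i = false} u‖) ∧
  (∀ y ∈ sspan x0 {i | σ i = false},
      ∃ u ∈ sspan x1 {i | σ i = false}, bproj x0 xs0 {i | σ i = false} u = y) ∧
  (∀ u ∈ sspan x0 {i | σ i = false},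
      bproj x1 xs1 {i | σ i = false} u ∈ sspan x1 {i | σ i = false} ∧
      ‖u‖ ≤ E * ‖bproj x1 xs1 {i | σ i = false} u‖) ∧
  (∀ y ∈ sspan x1 {i | σ i = false},
      ∃ u ∈ sspan x0 {i | σ i = false}, bproj x1 xs1 {i | σ i = false} u = y)

/-- Multiplying out the frame sum: continuity of the frame operator in `σ`. -/
theorem cont_weave (a b : ℕ → X) (ha : Summable a) (hb : Summable b)
    (s : (ℕ → Bool) → X) (hs : ∀ σ, HasSum (weave a b σ) (s σ)) : Continuous s := by
  have hu : TendstoUniformly (fun (t : Finset ℕ) (σ : ℕ → Bool) => ∑ i ∈ t, weave a b σ i) s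
      atTop := by
    rw [Metric.tendstoUniformly_iff]
    intro ε hε
    obtain ⟨s1, h1⟩ := summable_iff_vanishing_norm.1 ha (ε / 4) (by positivity)
    obtain ⟨s2, h2⟩ := summable_iff_vanishing_norm.1 hb (ε / 4) (by positivity)
    filter_upwards [eventually_ge_atTop (s1 ∪ s2)] with t ht σ
    have key : ∀ t', t ≤ t' → ‖∑ i ∈ t', weave a b σ i - ∑ i ∈ t, weave a b σ i‖ ≤ ε / 2 := by
      intro t' htt
      have hd : ∑ i ∈ t', weave a b σ i - ∑ i ∈ t, weave a b σ i
          = ∑ i ∈ (t' \ t) with σ i = true, b i + ∑ i ∈ (t' \ t) with ¬ σ i = true, a i := by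
        rw [← Finset.sum_sdiff htt, add_sub_cancel_right, ← Finset.sum_ite]
        rfl
      rw [hd]
      have e1 := h2 ((t' \ t).filter (fun i => σ i = true)) (by
        rw [Finset.disjoint_left]
        intro i hi hi2
        simp only [Finset.mem_filter, Finset.mem_sdiff] at hi
        exact hi.1.2 (ht (Finset.mem_union_right _ hi2)))
      have e2 := h1 ((t' \ t).filter (fun i => ¬ σ i = true)) (by
        rw [Finset.disjoint_left]
        intro i hi hi2
        simp only [Finset.mem_filter, Finset.mem_sdiff] at hi
        exact hi.1.2 (ht (Finset.mem_union_left _ hi2)))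
      refine (norm_add_le _ _).trans ?_
      linarith
    have hlim : Tendsto (fun t' : Finset ℕ => ‖∑ i ∈ t', weave a b σ i - ∑ i ∈ t, weave a b σ i‖)
        atTop (𝓝 ‖s σ - ∑ i ∈ t, weave a b σ i‖) :=
      (Tendsto.sub (hs σ) tendsto_const_nhds).norm
    have := le_of_tendsto hlim ((eventually_ge_atTop t).mono key)
    rw [dist_eq_norm]
    linarith
  refine hu.continuous (Frequently.of_forall fun t => ?_)
  refine continuous_finset_sum _ fun i _ => ?_
  have : (fun σ : ℕ → Bool => weave a b σ i)
      = (fun c : Bool => if c then b i else a i) ∘ (fun σ => σ i) := rfl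
  rw [this]
  exact continuous_of_discreteTopology.comp (continuous_apply i)

theorem weave_smul (x0 x1 : ℕ → X) (xs0 xs1 : ℕ → X →L[ℝ] ℝ) (σ : ℕ → Bool) (v : X) :
    (fun i => weave xs0 xs1 σ i v • weave x0 x1 σ i)
      = weave (fun i => xs0 i v • x0 i) (fun i => xs1 i v • x1 i) σ := by
  funext i
  simp only [weave]
  split_ifs <;> rfl

theorem unif_bound (x0 x1 : ℕ → X) (xs0 xs1 : ℕ → X →L[ℝ] ℝ)
    (h0 : ∀ v, Summable (fun i => xs0 i v • x0 i)) (h1 : ∀ v, Summable (fun i => xs1 i v • x1 i))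
    (S : (ℕ → Bool) → X ≃L[ℝ] X)
    (hS : ∀ σ v, HasSum (fun i => weave xs0 xs1 σ i v • weave x0 x1 σ i) (S σ v)) :
    ∃ K > (0 : ℝ), ∀ σ v, ‖v‖ ≤ K * ‖S σ v‖ := by
  have hcont : ∀ v, Continuous (fun σ => S σ v) := fun v =>
    cont_weave _ _ (h0 v) (h1 v) _ (fun σ => by rw [← weave_smul]; exact hS σ v)
  have hinv : ∀ σ, ∃ K > (0 : ℝ), ∀ v, ‖v‖ ≤ K * ‖S σ v‖ := by
    intro σ
    refine ⟨‖((S σ).symm : X →L[ℝ] X)‖ + 1, by positivity, fun v => ?_⟩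
    have := ((S σ).symm : X →L[ℝ] X).le_opNorm (S σ v)
    simp only [ContinuousLinearEquiv.coe_coe, ContinuousLinearEquiv.symm_apply_apply] at this
    nlinarith [norm_nonneg (S σ v)]
  -- Baire
  obtain ⟨n, τ0, hτ0⟩ := nonempty_interior_of_iUnion_of_closed
    (f := fun n : ℕ => {σ : ℕ → Bool | ∀ v, ‖v‖ ≤ (n : ℝ) * ‖S σ v‖})
    (fun n => by
      simp only [Set.setOf_forall]
      exact isClosed_iInter fun v =>
        isClosed_le continuous_const (continuous_const.mul (hcont v).norm))
    (by
      ext σ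
      simp only [Set.mem_iUnion, Set.mem_setOf_eq, Set.mem_univ, iff_true]
      obtain ⟨K, hK, h⟩ := hinv σ
      obtain ⟨n, hn⟩ := exists_nat_ge K
      exact ⟨n, fun v => (h v).trans (by gcongr)⟩)
  obtain ⟨I, u, hu, hsub⟩ := isOpen_pi_iff.1 isOpen_interior τ0 hτ0
  let p : (ℕ → Bool) → ℕ → Bool := fun τ i => if i ∈ I then τ0 i else τ i
  have hpA : ∀ τ v, ‖v‖ ≤ (n : ℝ) * ‖S (p τ) v‖ := by
    intro τ
    have : p τ ∈ (I : Set ℕ).pi u := by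
      intro i hi
      have hi' : i ∈ I := hi
      simp only [p, hi', if_true]
      exact (hu i hi').2
    exact interior_subset (hsub this)
  have hpc : Continuous p := by
    refine continuous_pi fun i => ?_
    by_cases hi : i ∈ I
    · simp only [p, hi, if_true]; exact continuous_const
    · simp only [p, hi, if_false]; exact continuous_apply i
  let F : (ℕ → Bool) → ℕ → X → X := fun σ i v => weave xs0 xs1 σ i v • weave x0 x1 σ i
  have hdiff : ∀ τ v, S τ v - S (p τ) v = ∑ i ∈ I, (F τ i v - F τ0 i v) := by
    intro τ v
    have e1 := (hS τ v).sub (hS (p τ) v)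
    have e2 : ∑ i ∈ I, (F τ i v - F τ0 i v) = ∑ i ∈ I, (F τ i v - F (p τ) i v) := by
      refine Finset.sum_congr rfl fun i hi => ?_
      simp only [F, weave, p, hi, if_true]
    rw [e2]
    refine e1.unique (hasSum_sum_of_ne_finset_zero fun i hi => ?_)
    simp only [weave, p, hi, if_false, sub_self]
  -- local bound
  have hloc : ∀ σ', ∃ K > (0 : ℝ), ∀ᶠ τ in 𝓝 σ', ∀ v, ‖v‖ ≤ K * ‖S τ v‖ := by
    intro σ'
    obtain ⟨M, hM, hM'⟩ := hinv σ'
    set A : ℝ := ‖(S (p σ') : X →L[ℝ] X)‖ with hA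
    let w : (ℕ → Bool) → ℕ → X := fun ρ i => (S (p σ')).symm (weave x0 x1 ρ i)
    let ε : (ℕ → Bool) → ℝ := fun τ => ∑ i ∈ I,
      (‖weave xs0 xs1 σ' i‖ * ‖S (p σ') (w σ' i) - S (p τ) (w σ' i)‖
        + ‖weave xs0 xs1 τ0 i‖ * ‖S (p σ') (w τ0 i) - S (p τ) (w τ0 i)‖)
    have hεc : Continuous ε := by
      refine continuous_finset_sum _ fun i _ => ?_
      exact (continuous_const.mul (continuous_const.sub ((hcont _).comp hpc)).norm).add
        (continuous_const.mul (continuous_const.sub ((hcont _).comp hpc)).norm)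
    have hε0 : ε σ' = 0 := by simp [ε]
    -- constant
    set L : ℝ := M * (A + 1) * (n + 1) with hL
    have hA0 : 0 ≤ A := norm_nonneg _
    have hLpos : 0 < L := by positivity
    have hev : ∀ᶠ τ in 𝓝 σ', ε τ < 1 / (2 * L) :=
      (hεc.tendsto σ').eventually (gt_mem_nhds (by rw [hε0]; positivity))
    have hag : ∀ᶠ τ in 𝓝 σ', ∀ i ∈ I, τ i = σ' i := by
      rw [Filter.eventually_all_finset]
      intro i _
      have := (continuous_apply (A := fun _ : ℕ => Bool) i).tendsto σ'
      exact this.eventually (p := fun b => b = σ' i) (by rw [nhds_discrete]; exact Filter.eventually_pure.2 rfl)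
    refine ⟨2 * L, by positivity, ?_⟩
    filter_upwards [hev, hag] with τ h1 h2 v
    let T : X := ∑ i ∈ I, (weave xs0 xs1 σ' i v • w σ' i - weave xs0 xs1 τ0 i v • w τ0 i)
    have hST : S (p σ') T = S σ' v - S (p σ') v := by
      rw [hdiff]
      simp only [T, map_sum, map_sub, map_smul, w, ContinuousLinearEquiv.apply_symm_apply, F]
    have hτσ : S τ v - S (p τ) v = S σ' v - S (p σ') v := by
      rw [hdiff, hdiff]
      refine Finset.sum_congr rfl fun i hi => ?_
      simp only [F, weave, h2 i hi]
    have herr : ‖S (p σ') T - S (p τ) T‖ ≤ ε τ * ‖v‖ := by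
      have : S (p σ') T - S (p τ) T = ∑ i ∈ I,
          (weave xs0 xs1 σ' i v • (S (p σ') (w σ' i) - S (p τ) (w σ' i))
            - weave xs0 xs1 τ0 i v • (S (p σ') (w τ0 i) - S (p τ) (w τ0 i))) := by
        simp only [T, map_sum, map_sub, map_smul]
        rw [← Finset.sum_sub_distrib]
        refine Finset.sum_congr rfl fun i _ => ?_
        module
      rw [this]
      simp only [ε]
      rw [Finset.sum_mul]
      refine norm_sum_le_of_le _ fun i _ => ?_
      refine (norm_sub_le _ _).trans ?_
      rw [norm_smul, norm_smul]
      have a1 := (weave xs0 xs1 σ' i).le_opNorm v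
      have a2 := (weave xs0 xs1 τ0 i).le_opNorm v
      have b1 := mul_le_mul_of_nonneg_right a1
        (norm_nonneg (S (p σ') (w σ' i) - S (p τ) (w σ' i)))
      have b2 := mul_le_mul_of_nonneg_right a2
        (norm_nonneg (S (p σ') (w τ0 i) - S (p τ) (w τ0 i)))
      linarith
    have hvT : S (p σ') (v + T) = S σ' v := by rw [map_add, hST]; abel
    have c1 : ‖S σ' v‖ ≤ A * ‖v + T‖ := by
      rw [← hvT]; exact (S (p σ') : X →L[ℝ] X).le_opNorm _
    have c2 := hpA τ (v + T)
    have c3 : S (p τ) (v + T) = S τ v - (S (p σ') T - S (p τ) T) := by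
      rw [hST, ← hτσ, map_add]; abel
    have c4 : ‖S (p τ) (v + T)‖ ≤ ‖S τ v‖ + ε τ * ‖v‖ := by
      rw [c3]; exact (norm_sub_le _ _).trans (by gcongr)
    have c5 : ‖v‖ ≤ L * (‖S τ v‖ + ε τ * ‖v‖) := by
      calc ‖v‖ ≤ M * ‖S σ' v‖ := hM' v
        _ ≤ M * (A * ‖v + T‖) := by gcongr
        _ ≤ M * ((A + 1) * ‖v + T‖) := by gcongr; linarith
        _ ≤ M * ((A + 1) * (n * ‖S (p τ) (v + T)‖)) := by gcongr
        _ ≤ M * ((A + 1) * ((n + 1) * ‖S (p τ) (v + T)‖)) := by gcongr; linarith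
        _ ≤ M * ((A + 1) * ((n + 1) * (‖S τ v‖ + ε τ * ‖v‖))) := by gcongr
        _ = _ := by rw [hL]; ring
    have c6 : L * (ε τ * ‖v‖) ≤ ‖v‖ / 2 := by
      have : L * ε τ ≤ 1 / 2 := by
        calc L * ε τ ≤ L * (1 / (2 * L)) := by gcongr
          _ = 1 / 2 := by field_simp
      nlinarith [norm_nonneg v]
    nlinarith
  have := isCompact_univ.induction_on (X := ℕ → Bool)
    (p := fun s => ∃ K > (0 : ℝ), ∀ τ ∈ s, ∀ v, ‖v‖ ≤ K * ‖S τ v‖)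
    ⟨1, one_pos, by simp⟩
    (fun s t hst ⟨K, hK, h⟩ => ⟨K, hK, fun τ hτ => h τ (hst hτ)⟩)
    (fun s t ⟨K, hK, h⟩ ⟨K', hK', h'⟩ => ⟨K + K', by positivity, fun τ hτ v => by
      rcases hτ with hτ | hτ
      · have := h τ hτ v
        nlinarith [norm_nonneg (S τ v)]
      · have := h' τ hτ v
        nlinarith [norm_nonneg (S τ v)]⟩)
    (fun σ _ => by
      obtain ⟨K, hK, h⟩ := hloc σ
      exact ⟨_, mem_nhdsWithin_of_mem_nhds h, K, hK, fun τ hτ => hτ⟩)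
  obtain ⟨K, hK, h⟩ := this
  exact ⟨K, hK, fun σ => h σ (Set.mem_univ σ)⟩

theorem coeff_zero {x : ℕ → X} {xs : ℕ → X →L[ℝ] ℝ} {C : ℝ} (hb : IsUncondBasisWith x xs C)
    {Γ : Set ℕ} {u : X} (hu : u ∈ sspan x Γ) {i : ℕ} (hi : i ∉ Γ) : xs i u = 0 := by
  have : sspan x Γ ≤ LinearMap.ker (xs i : X →ₗ[ℝ] ℝ) := by
    refine Submodule.topologicalClosure_minimal _ ?_ (xs i).isClosed_ker
    rw [Submodule.span_le]
    rintro _ ⟨j, hj, rfl⟩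
    have hne : i ≠ j := fun h => hi (h ▸ hj)
    simp [hb.1 i j, hne]
  exact this hu

theorem hasSum_mem {x : ℕ → X} {Γ : Set ℕ} {c : ℕ → ℝ} {v : X}
    (h : HasSum (fun i => c i • x i) v) (hc : ∀ i ∉ Γ, c i = 0) : v ∈ sspan x Γ := by
  have hcl : IsClosed ((sspan x Γ : Submodule ℝ X) : Set X) :=
    Submodule.isClosed_topologicalClosure _
  refine hcl.mem_of_tendsto h (Eventually.of_forall fun t => ?_)
  refine Submodule.sum_mem _ fun i _ => ?_
  by_cases hi : i ∈ Γ
  · exact Submodule.smul_mem _ _ (Submodule.le_topologicalClosure _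
      (Submodule.subset_span ⟨i, hi, rfl⟩))
  · rw [hc i hi, zero_smul]; exact Submodule.zero_mem _

open Classical in
theorem hasSum_bproj {x : ℕ → X} {xs : ℕ → X →L[ℝ] ℝ} {C : ℝ} (hb : IsUncondBasisWith x xs C)
    (Γ : Set ℕ) (v : X) :
    HasSum (fun i => (if i ∈ Γ then xs i v else 0) • x i) (bproj x xs Γ v) := by
  have h1 := (((hb.2.1 v).summable).subtype Γ).hasSum
  have h2 := (hasSum_subtype_iff_indicator (f := fun i => xs i v • x i) (s := Γ)).1 h1
  have h3 : bproj x xs Γ v = ∑' b : Subtype Γ, ((fun j => xs j v • x j) ∘ Subtype.val) b := rfl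
  rw [h3]
  convert h2 using 1
  funext i
  by_cases hi : i ∈ Γ <;> simp [hi]

theorem half (x0 x1 : ℕ → X) (xs0 xs1 : ℕ → X →L[ℝ] ℝ) (C : ℝ)
    (hb0 : IsUncondBasisWith x0 xs0 C) (hb1 : IsUncondBasisWith x1 xs1 C)
    (hw : ∀ σ : ℕ → Bool, ∃ S : X ≃L[ℝ] X,
      ∀ v : X, HasSum (fun i => weave xs0 xs1 σ i v • weave x0 x1 σ i) (S v)) :
    ∃ E > (0 : ℝ), ∀ σ : ℕ → Bool,
      (∀ u ∈ sspan x1 {i | σ i = false},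
        bproj x0 xs0 {i | σ i = false} u ∈ sspan x0 {i | σ i = false} ∧
        ‖u‖ ≤ E * ‖bproj x0 xs0 {i | σ i = false} u‖) ∧
      (∀ y ∈ sspan x0 {i | σ i = false},
        ∃ u ∈ sspan x1 {i | σ i = false}, bproj x0 xs0 {i | σ i = false} u = y) := by
  classical
  choose S hS using hw
  obtain ⟨E, hE, hbd⟩ := unif_bound x0 x1 xs0 xs1 (fun v => (hb0.2.1 v).summable)
    (fun v => (hb1.2.1 v).summable) S hS
  refine ⟨E, hE, fun σ => ?_⟩
  set Γ : Set ℕ := {i | σ i = false} with hΓ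
  have hmem : ∀ (x : ℕ → X) (xs : ℕ → X →L[ℝ] ℝ) (Γ : Set ℕ) (v : X),
      IsUncondBasisWith x xs C → bproj x xs Γ v ∈ sspan x Γ := fun x xs Γ v hb =>
    hasSum_mem (hasSum_bproj hb Γ v) (fun i hi => by simp [hi])
  have hdec : ∀ v, S σ v = bproj x0 xs0 Γ v + bproj x1 xs1 Γᶜ v := by
    intro v
    refine (hS σ v).unique ?_
    convert (hasSum_bproj hb0 Γ v).add (hasSum_bproj hb1 Γᶜ v) using 1
    funext i
    cases h : σ i <;> simp [weave, hΓ, h]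
  have hz : ∀ u ∈ sspan x1 Γ, S σ u = bproj x0 xs0 Γ u := by
    intro u hu
    refine (hS σ u).unique ?_
    convert hasSum_bproj hb0 Γ u using 1
    funext i
    cases h : σ i
    · simp [weave, hΓ, h]
    · simp [weave, hΓ, h, coeff_zero hb1 hu (i := i) (by simp [hΓ, h])]
  refine ⟨fun u hu => ⟨hmem x0 xs0 Γ u hb0, ?_⟩, fun y hy => ?_⟩
  · rw [← hz u hu]; exact hbd σ u
  · let v := (S σ).symm y
    have hv : S σ v = y := (S σ).apply_symm_apply y
    have hw0 : bproj x1 xs1 Γᶜ v = 0 := by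
      set w := bproj x1 xs1 Γᶜ v with hwdef
      have m1 : w ∈ sspan x1 Γᶜ := hmem _ _ _ _ hb1
      have m0 : w ∈ sspan x0 Γ := by
        have : w = y - bproj x0 xs0 Γ v := by rw [← hv, hdec]; abel
        rw [this]
        exact Submodule.sub_mem _ hy (hmem _ _ _ _ hb0)
      have : S (fun i => !σ i) w = 0 := by
        refine (hS _ w).unique ?_
        convert hasSum_zero (α := X) (β := ℕ) using 1
        funext i
        cases h : σ i
        · simp [weave, h, coeff_zero hb1 m1 (i := i) (by simp [hΓ, h])]
        · simp [weave, h, coeff_zero hb0 m0 (i := i) (by simp [hΓ, h])]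
      exact (S (fun i => !σ i)).map_eq_zero_iff.1 this
    refine ⟨v, ?_, ?_⟩
    · refine hasSum_mem (hb1.2.1 v) fun i hi => ?_
      have h1 := (hasSum_bproj hb1 Γᶜ v).mapL (xs1 i)
      rw [hw0] at h1
      have h2 := h1.unique (hasSum_single i fun j hj => by
        rw [map_smul, hb1.1 i j, if_neg hj.symm, smul_zero])
      simpa [hb1.1 i i, hi] using h2.symm
    · rw [← hv, hdec, hw0, add_zero]

theorem stmt15 (x0 x1 : ℕ → X) (xs0 xs1 : ℕ → X →L[ℝ] ℝ) (C : ℝ) (hC : 1 ≤ C)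
    (hb0 : IsUncondBasisWith x0 xs0 C) (hb1 : IsUncondBasisWith x1 xs1 C)
    -- every weaving `(x^{σ(i)}_i, x^{σ(i)*}_i)` is an unconditional approximate
    -- Schauder frame for `X` (with frame operator `S`, bounded with bounded inverse):
    (hw : ∀ σ : ℕ → Bool, ∃ S : X ≃L[ℝ] X,
      ∀ v : X, HasSum (fun i => weave xs0 xs1 σ i v • weave x0 x1 σ i) (S v)) :
    ∃ E > (0 : ℝ), ∀ σ : ℕ → Bool, RestrictionsInvertible x0 x1 xs0 xs1 σ E := by
  obtain ⟨E, hE, h⟩ := half x0 x1 xs0 xs1 C hb0 hb1 hw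
  obtain ⟨E', hE', h'⟩ := half x1 x0 xs1 xs0 C hb1 hb0 (fun σ => by
    obtain ⟨S, hS⟩ := hw (fun i => !σ i)
    refine ⟨S, fun v => ?_⟩
    convert hS v using 1
    funext i
    cases hi : σ i <;> simp [weave, hi])
  refine ⟨E + E', by positivity, fun σ => ⟨fun u hu => ⟨((h σ).1 u hu).1, ?_⟩, (h σ).2,
    fun u hu => ⟨((h' σ).1 u hu).1, ?_⟩, (h' σ).2⟩⟩
  · refine ((h σ).1 u hu).2.trans ?_
    gcongr
    linarith
  · refine ((h' σ).1 u hu).2.trans ?_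
    gcongr
    linarith
end

section
/- Suppose (x_i, f_i)_{i∈ℕ} is a C-suppression unconditional approximate Schauder frame for a Banach space X with frame operator S, and T : X → X is a bounded linear operator satisfying ‖Id − T‖ < C⁻¹. Then for every σ : ℕ → {0,1}, the weaving of (x_i, f_i)_{i∈ℕ} and (T x_i, f_i)_{i∈ℕ} has a well-defined frame operator S_σ (the series ∑_i f_i(x) x^{σ(i)}_i, where x^0_i = x_i and x^1_i = T x_i, converges unconditionally for every x), and S_σ satisfies ‖Id − S_σ S⁻¹‖ ≤ C‖Id − T‖ < 1; consequently every such weaving, and in particular (T x_i, f_i)_{i∈ℕ} itself, is an unconditional approximate Schauder frame for X. -/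
open Filter Topology

variable {X : Type*} [NormedAddCommGroup X] [NormedSpace ℝ X] [CompleteSpace X]

theorem stmt16 (x : ℕ → X) (f : ℕ → X →L[ℝ] ℝ) (S : X ≃L[ℝ] X) (C : ℝ) (hC : 1 ≤ C)
    -- `(x, f)` is an unconditional approximate Schauder frame with frame operator `S`:
    (hu : ∀ v : X, HasSum (fun i => f i v • x i) (S v))
    -- which is `C`-suppression unconditional:
    (hsupp : ∀ (v : X) (Γ : Set ℕ), ‖∑' i : Γ, f (i : ℕ) v • x (i : ℕ)‖ ≤ C * ‖S v‖)
    -- `T` is a bounded operator with `‖Id − T‖ < C⁻¹`: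
    (T : X →L[ℝ] X) (hT : ‖ContinuousLinearMap.id ℝ X - T‖ < C⁻¹) :
    ∀ σ : ℕ → Bool, ∃ Sσ : X ≃L[ℝ] X,
      -- the weaving of `(x i, f i)` and `(T (x i), f i)` has well-defined frame
      -- operator `Sσ`, the series converging unconditionally; `Sσ` is bounded with
      -- bounded inverse, so the weaving is an unconditional approximate Schauder frame:
      (∀ v : X, HasSum (fun i => f i v • (if σ i then T (x i) else x i)) (Sσ v)) ∧
      -- and `‖Id − Sσ S⁻¹‖ ≤ C‖Id − T‖ < 1`:
      ‖ContinuousLinearMap.id ℝ X - (Sσ : X →L[ℝ] X).comp (S.symm : X →L[ℝ] X)‖ ≤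
        C * ‖ContinuousLinearMap.id ℝ X - T‖ ∧
      C * ‖ContinuousLinearMap.id ℝ X - T‖ < 1 := by
  intro σ
  have hC0 : 0 < C := by linarith
  have hlt : C * ‖ContinuousLinearMap.id ℝ X - T‖ < 1 := by
    have := mul_lt_mul_of_pos_left hT hC0
    rwa [mul_inv_cancel₀ hC0.ne'] at this
  let Γ : Set ℕ := {i | σ i = true}
  have hsum : ∀ v : X, Summable (fun i : Γ => f (i : ℕ) v • x (i : ℕ)) := fun v =>
    (hu v).summable.subtype Γ
  let R0 : X →ₗ[ℝ] X :=
    { toFun := fun w => ∑' i : Γ, f (i : ℕ) (S.symm w) • x (i : ℕ)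
      map_add' := by
        intro a b
        rw [← (hsum _).tsum_add (hsum _)]
        simp only [map_add, add_smul]
      map_smul' := by
        intro c a
        simp only [map_smul, smul_eq_mul, mul_smul, RingHom.id_apply]
        exact (hsum _).tsum_const_smul c }
  have hR0 : ∀ w, ‖R0 w‖ ≤ C * ‖w‖ := by
    intro w
    have := hsupp (S.symm w) Γ
    rwa [S.apply_symm_apply] at this
  let R : X →L[ℝ] X := R0.mkContinuous C hR0
  have hR : ‖R‖ ≤ C := R0.mkContinuous_norm_le hC0.le hR0
  let D : X →L[ℝ] X := ContinuousLinearMap.id ℝ X - T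
  let B : X →L[ℝ] X := D * R
  have hB : ‖B‖ ≤ C * ‖D‖ := by
    calc ‖B‖ ≤ ‖D‖ * ‖R‖ := norm_mul_le _ _
      _ ≤ ‖D‖ * C := by gcongr
      _ = C * ‖D‖ := mul_comm _ _
  let A : X ≃L[ℝ] X := ContinuousLinearEquiv.unitsEquiv ℝ X (Units.oneSub B (hB.trans_lt hlt))
  have hA : ∀ w, A w = w - B w := fun w => rfl
  refine ⟨S.trans A, ?_, ?_, hlt⟩
  · intro v
    have h1 : HasSum (Γ.indicator (fun i => f i v • x i)) (R (S v)) := by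
      have h2 : HasSum (fun i : Γ => f (i : ℕ) v • x (i : ℕ)) (R (S v)) := by
        have h3 : R (S v) = ∑' i : Γ, f (i : ℕ) v • x (i : ℕ) := by
          change ∑' i : Γ, f (i : ℕ) (S.symm (S v)) • x (i : ℕ) = _
          rw [S.symm_apply_apply]
        rw [h3]
        exact (hsum v).hasSum
      exact hasSum_subtype_iff_indicator.mp h2
    have h4 := (hu v).sub (D.hasSum h1)
    convert h4 using 1
    funext i
    by_cases h : σ i = true
    · have hi : i ∈ Γ := h
      simp [h, hi, D, smul_sub]
    · have hi : i ∉ Γ := h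
      simp [h, hi]
    exact hA (S v)
  · have : ContinuousLinearMap.id ℝ X - ((S.trans A : X ≃L[ℝ] X) : X →L[ℝ] X).comp
        (S.symm : X →L[ℝ] X) = B := by
      ext w
      simp [hA]
    rw [this]
    exact hB
end

section
/- Suppose (x⁰_i, f⁰_i)_{i∈ℕ} is an approximate Schauder frame for a Banach space X with frame operator S, and (x¹_i, f¹_i)_{i∈ℕ} is a sequence in X × X* satisfying ∑_{i=1}^∞ (‖f⁰_i − f¹_i‖·‖x⁰_i‖ + ‖x⁰_i − x¹_i‖·‖f¹_i‖) < ‖S⁻¹‖⁻¹. Then for every σ : ℕ → {0,1}, the weaving frame operator T_σ x = ∑_{i=1}^∞ f^{σ(i)}_i(x) x^{σ(i)}_i is well defined (the partial sums converge for every x ∈ X) and satisfies ‖Id − T_σ S⁻¹‖ ≤ ‖S⁻¹‖ ∑_{i=1}^∞ (‖f⁰_i − f¹_i‖·‖x⁰_i‖ + ‖x⁰_i − x¹_i‖·‖f¹_i‖) < 1; consequently every weaving, and in particular (x¹_i, f¹_i)_{i∈ℕ} itself, is an approximate Schauder frame for X. -/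
open Filter Topology

variable {X : Type*} [NormedAddCommGroup X] [NormedSpace ℝ X] [CompleteSpace X]

theorem stmt17 (x0 x1 : ℕ → X) (f0 f1 : ℕ → X →L[ℝ] ℝ) (S : X ≃L[ℝ] X)
    -- `(x0, f0)` is an approximate Schauder frame with frame operator `S`:
    (hS : ∀ v : X,
      Tendsto (fun n => ∑ i ∈ Finset.range n, f0 i v • x0 i) atTop (𝓝 (S v)))
    -- the perturbation condition
    -- `∑ᵢ (‖f⁰ᵢ − f¹ᵢ‖‖x⁰ᵢ‖ + ‖x⁰ᵢ − x¹ᵢ‖‖f¹ᵢ‖) < ‖S⁻¹‖⁻¹`: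
    (hsum : Summable (fun i => ‖f0 i - f1 i‖ * ‖x0 i‖ + ‖x0 i - x1 i‖ * ‖f1 i‖))
    (hlt : (∑' i, (‖f0 i - f1 i‖ * ‖x0 i‖ + ‖x0 i - x1 i‖ * ‖f1 i‖)) <
      ‖(S.symm : X →L[ℝ] X)‖⁻¹) :
    ∀ σ : ℕ → Bool, ∃ Tσ : X ≃L[ℝ] X,
      -- the weaving frame operator `Tσ` is well defined (partial sums converge),
      -- bounded with bounded inverse, so every weaving (in particular
      -- `(x1, f1)` itself, for `σ ≡ 1`) is an approximate Schauder frame: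
      (∀ v : X, Tendsto (fun n => ∑ i ∈ Finset.range n, weave f0 f1 σ i v • weave x0 x1 σ i)
        atTop (𝓝 (Tσ v))) ∧
      -- with `‖Id − Tσ S⁻¹‖ ≤ ‖S⁻¹‖ ∑ᵢ (‖f⁰ᵢ − f¹ᵢ‖‖x⁰ᵢ‖ + ‖x⁰ᵢ − x¹ᵢ‖‖f¹ᵢ‖) < 1`:
      ‖ContinuousLinearMap.id ℝ X - (Tσ : X →L[ℝ] X).comp (S.symm : X →L[ℝ] X)‖ ≤
        ‖(S.symm : X →L[ℝ] X)‖ *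
          ∑' i, (‖f0 i - f1 i‖ * ‖x0 i‖ + ‖x0 i - x1 i‖ * ‖f1 i‖) ∧
      ‖(S.symm : X →L[ℝ] X)‖ *
          (∑' i, (‖f0 i - f1 i‖ * ‖x0 i‖ + ‖x0 i - x1 i‖ * ‖f1 i‖)) < 1 := by
  intro σ
  set a : ℕ → ℝ := fun i => ‖f0 i - f1 i‖ * ‖x0 i‖ + ‖x0 i - x1 i‖ * ‖f1 i‖ with ha
  have ha0 : ∀ i, 0 ≤ a i := fun i => by simp only [ha]; positivity
  have hA0 : 0 ≤ ∑' i, a i := tsum_nonneg ha0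
  have hN : 0 < ‖(S.symm : X →L[ℝ] X)‖ := inv_pos.mp (hA0.trans_lt hlt)
  have hlt1 : ‖(S.symm : X →L[ℝ] X)‖ * ∑' i, a i < 1 := by
    have h := mul_lt_mul_of_pos_left hlt hN
    rwa [mul_inv_cancel₀ hN.ne'] at h
  let D : ℕ → X →L[ℝ] X := fun i =>
    if σ i then (f0 i - f1 i).smulRight (x0 i) + (f1 i).smulRight (x0 i - x1 i) else 0
  have hD : ∀ i, ‖D i‖ ≤ a i := by
    intro i
    by_cases h : σ i
    · simp only [D, h, if_true]
      refine (norm_add_le _ _).trans ?_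
      rw [ContinuousLinearMap.norm_smulRight_apply, ContinuousLinearMap.norm_smulRight_apply]
      simp only [ha]
      rw [mul_comm ‖f1 i‖]
    · simp only [D, h]
      simpa using ha0 i
  have hDs : Summable D := Summable.of_norm_bounded hsum hD
  let E : X →L[ℝ] X := ∑' i, D i
  have hE : ‖E‖ ≤ ∑' i, a i := tsum_of_norm_bounded hsum.hasSum hD
  have hES : ‖E.comp (S.symm : X →L[ℝ] X)‖ ≤ ‖(S.symm : X →L[ℝ] X)‖ * ∑' i, a i := by
    refine (ContinuousLinearMap.opNorm_comp_le _ _).trans ?_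
    rw [mul_comm]
    exact mul_le_mul_of_nonneg_left hE hN.le
  let u : (X →L[ℝ] X)ˣ := Units.oneSub (E.comp (S.symm : X →L[ℝ] X)) (hES.trans_lt hlt1)
  have hu : ∀ v, (S.trans (ContinuousLinearEquiv.ofUnit u)) v = S v - E v := by
    intro v
    change (u : X →L[ℝ] X) (S v) = _
    simp [u]
  refine ⟨S.trans (ContinuousLinearEquiv.ofUnit u), ?_, ?_, hlt1⟩
  · intro v
    rw [hu]
    have h1 : Tendsto (fun n => ∑ i ∈ Finset.range n, D i v) atTop (𝓝 (E v)) :=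
      (hDs.hasSum.mapL (ContinuousLinearMap.apply ℝ X v)).tendsto_sum_nat
    refine ((hS v).sub h1).congr ?_
    intro n
    rw [← Finset.sum_sub_distrib]
    refine Finset.sum_congr rfl fun i _ => ?_
    by_cases h : σ i
    · simp only [D, weave, h, if_true, ContinuousLinearMap.add_apply,
        ContinuousLinearMap.smulRight_apply, ContinuousLinearMap.sub_apply]
      module
    · simp [D, weave, h]
  · refine le_of_eq_of_le ?_ hES
    congr 1
    ext w
    have := hu (S.symm w)
    simp only [ContinuousLinearMap.sub_apply, ContinuousLinearMap.comp_apply,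
      ContinuousLinearMap.id_apply, ContinuousLinearEquiv.coe_coe]
    rw [this]
    simp
end
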